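/- Let n be a positive integer divisible by 3, let P be a 3-decomposable set of n points in general position in the plane, and let k be an integer with 1 ≤ k < n/2. Then χ_{≤k}(P) ≥ B(k,n). -/

import Mathlib

/-- Dot product of two planar vectors. -/
def dot (p v : ℝ × ℝ) : ℝ := p.1 * v.1 + p.2 * v.2

/-- A finite planar point set is in general position if no three of its points are collinear. -/
def GenPos (P : Finset (ℝ × ℝ)) : Prop :=
  ∀ p ∈ P, ∀ q ∈ P, ∀ r ∈ P, p ≠ q → p ≠ r → q ≠ r →
    ¬ Collinear ℝ ({p, q, r} : Set (ℝ × ℝ))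

/-- 3-decomposability of a planar point set. -/
def ThreeDecompPts (P : Finset (ℝ × ℝ)) : Prop :=
  ∃ A B C : Finset (ℝ × ℝ),
    Disjoint A B ∧ Disjoint A C ∧ Disjoint B C ∧ A ∪ B ∪ C = P ∧
    3 * A.card = P.card ∧ 3 * B.card = P.card ∧ 3 * C.card = P.card ∧
    ∃ v₁ v₂ v₃ : ℝ × ℝ, v₁ ≠ 0 ∧ v₂ ≠ 0 ∧ v₃ ≠ 0 ∧
      (∀ t : ℝ, v₂ ≠ t • v₁) ∧ (∀ t : ℝ, v₃ ≠ t • v₁) ∧ (∀ t : ℝ, v₃ ≠ t • v₂) ∧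
      ∀ a ∈ A, ∀ b ∈ B, ∀ c ∈ C,
        dot b v₁ < dot a v₁ ∧ dot a v₁ < dot c v₁ ∧
        dot a v₂ < dot b v₂ ∧ dot b v₂ < dot c v₂ ∧
        dot a v₃ < dot c v₃ ∧ dot c v₃ < dot b v₃

/-- `chiLe P k` is the number of `(≤ k)`-sets of `P`: nonempty subsets of `P` of size at most `k`
that can be cut off from `P` by an open halfplane. -/
noncomputable def chiLe (P : Finset (ℝ × ℝ)) (k : ℕ) : ℕ :=
  Set.ncard {S : Finset (ℝ × ℝ) | S.Nonempty ∧ S.card ≤ k ∧ S ⊆ P ∧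
    ∃ v : ℝ × ℝ, v ≠ 0 ∧ ∃ a : ℝ, ∀ p ∈ P, (p ∈ S ↔ dot p v < a)}

/-- The formal binomial coefficient `binom(r,2)` of a real number: `r(r-1)/2` if `r ≥ 2`,
and `0` otherwise. -/
noncomputable def rbinom2 (r : ℝ) : ℝ := if 2 ≤ r then r * (r - 1) / 2 else 0

/-- `cseq j = 1/2 − 1/(3j(j+1))`. -/
noncomputable def cseq (j : ℕ) : ℝ := 1 / 2 - 1 / (3 * (j : ℝ) * ((j : ℝ) + 1))

/-- The lower bound `B(k,n)` (relative to the integer `s = s(k,n)`). -/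
noncomputable def Bkn (k n s : ℕ) : ℝ :=
  3 * rbinom2 ((k : ℝ) + 1) + 3 * rbinom2 ((k : ℝ) + 1 - (n : ℝ) / 3) +
    3 * ∑ j ∈ Finset.Icc 2 (s - 1), (j : ℝ) * ((j : ℝ) + 1) *
      rbinom2 ((k : ℝ) + 1 - cseq j * (n : ℝ))

open Filter Topology

/-- Twice the signed area of the triangle `pqr`. -/
def orient (p q r : ℝ × ℝ) : ℝ := (q.1 - p.1) * (r.2 - p.2) - (q.2 - p.2) * (r.1 - p.1)

/-- The number of points of `P` strictly to the left of the directed line `pq`. -/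
noncomputable def leftCount (P : Finset (ℝ × ℝ)) (p q : ℝ × ℝ) : ℕ :=
  (P.filter fun r => 0 < orient p q r).card

/-- Indicator of the pairs whose line has at least `k` points of `P` on each side. -/
noncomputable def central (P : Finset (ℝ × ℝ)) (k : ℕ) (p q : ℝ × ℝ) : ℤ :=
  if k ≤ leftCount P p q ∧ k ≤ leftCount P q p then 1 else 0

lemma sq_add_sq_pos_of_ne_zero {u : ℝ × ℝ} (hu : u ≠ 0) : 0 < u.1 ^ 2 + u.2 ^ 2 := by
  by_cases h1 : u.1 = 0
  · have h2 : u.2 ≠ 0 := fun h2 => hu (Prod.ext h1 h2)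
    positivity
  · positivity

lemma orient_swap (p q r : ℝ × ℝ) : orient q p r = -orient p q r := by
  unfold orient; ring

lemma GenPos.orient_ne_zero {P : Finset (ℝ × ℝ)} (h : GenPos P) {p q r : ℝ × ℝ}
    (hp : p ∈ P) (hq : q ∈ P) (hr : r ∈ P) (hpq : p ≠ q) (hpr : p ≠ r) (hqr : q ≠ r) :
    orient p q r ≠ 0 := by
  intro h0
  apply h p hp q hq r hr hpq hpr hqr
  rw [collinear_iff_of_mem (p₀ := p) (by simp)]
  refine ⟨q - p, ?_⟩
  have key : ∃ t : ℝ, r = t • (q - p) +ᵥ p := by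
    unfold orient at h0
    by_cases h1 : q.1 - p.1 = 0
    · have h2 : q.2 - p.2 ≠ 0 := fun h2 =>
        hpq (Prod.ext (by linarith) (by linarith))
      refine ⟨(r.2 - p.2) / (q.2 - p.2), Prod.ext ?_ ?_⟩
      · have : r.1 - p.1 = 0 := by
          have : (q.2 - p.2) * (r.1 - p.1) = 0 := by rw [h1] at h0; linarith
          exact (mul_eq_zero.1 this).resolve_left h2
        simp [h1]; linarith
      · simp only [vadd_eq_add, Prod.snd_add, Prod.smul_snd, Prod.snd_sub, smul_eq_mul]
        field_simp; ring
    · refine ⟨(r.1 - p.1) / (q.1 - p.1), Prod.ext ?_ ?_⟩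
      · simp only [vadd_eq_add, Prod.fst_add, Prod.smul_fst, Prod.fst_sub, smul_eq_mul]
        field_simp; ring
      · simp only [vadd_eq_add, Prod.snd_add, Prod.smul_snd, Prod.snd_sub, smul_eq_mul]
        field_simp; linarith
  intro x hx
  simp only [Set.mem_insert_iff, Set.mem_singleton_iff] at hx
  rcases hx with rfl | rfl | rfl
  · exact ⟨0, by simp⟩
  · exact ⟨1, by simp⟩
  · exact key

lemma leftCount_add_leftCount {P : Finset (ℝ × ℝ)} (h : GenPos P) {p q : ℝ × ℝ}
    (hp : p ∈ P) (hq : q ∈ P) (hpq : p ≠ q) :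
    leftCount P p q + leftCount P q p + 2 = P.card := by
  have h1 : leftCount P p q + leftCount P q p =
      ((P.filter fun r => 0 < orient p q r) ∪ P.filter fun r => 0 < orient q p r).card := by
    rw [Finset.card_union_of_disjoint, leftCount, leftCount]
    rw [Finset.disjoint_filter]
    intro r _ h1 h2
    rw [orient_swap] at h2
    linarith
  have h2 : ((P.filter fun r => 0 < orient p q r) ∪ P.filter fun r => 0 < orient q p r) =
      (P.erase p).erase q := by
    ext r
    simp only [Finset.mem_union, Finset.mem_filter, Finset.mem_erase, orient_swap p q]
    constructor
    · rintro (⟨hr, h0⟩ | ⟨hr, h0⟩) <;> refine ⟨?_, ?_, hr⟩ <;> rintro rfl <;>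
        simp [orient] at h0 <;> linarith
    · rintro ⟨h1, h2, hr⟩
      rcases lt_trichotomy (orient p q r) 0 with h0 | h0 | h0
      · exact Or.inr ⟨hr, by linarith⟩
      · exact absurd h0 (h.orient_ne_zero hp hq hr hpq (Ne.symm h2) (Ne.symm h1))
      · exact Or.inl ⟨hr, h0⟩
  have h3 := Finset.card_erase_add_one hp
  have h4 := Finset.card_erase_add_one (Finset.mem_erase.2 ⟨hpq.symm, hq⟩)
  rw [h1, h2]; omega

lemma central_comm (P : Finset (ℝ × ℝ)) (k : ℕ) (p q : ℝ × ℝ) :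
    central P k p q = central P k q p := by
  simp only [central, and_comm]

lemma central_nonneg (P : Finset (ℝ × ℝ)) (k : ℕ) (p q : ℝ × ℝ) : 0 ≤ central P k p q := by
  unfold central; split_ifs <;> simp

lemma central_le_one (P : Finset (ℝ × ℝ)) (k : ℕ) (p q : ℝ × ℝ) : central P k p q ≤ 1 := by
  unfold central; split_ifs <;> simp

lemma central_self (P : Finset (ℝ × ℝ)) {k : ℕ} (hk : 1 ≤ k) (p : ℝ × ℝ) :
    central P k p p = 0 := by
  have : leftCount P p p = 0 := by simp [leftCount, orient]
  simp [central, this]; omega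

/-! ### Counting `(≤ k)`-sets by directed pairs -/

/-- The set cut off by rotating the directed line `pq` slightly about an inner point of `pq`. -/
noncomputable def cutSet (P : Finset (ℝ × ℝ)) (x : (ℝ × ℝ) × (ℝ × ℝ)) : Finset (ℝ × ℝ) :=
  insert x.1 (P.filter fun r => 0 < orient x.1 x.2 r)

lemma orient_nonneg_of_mem_cutSet {P : Finset (ℝ × ℝ)} {p q r : ℝ × ℝ}
    (hr : r ∈ cutSet P (p, q)) : 0 ≤ orient p q r := by
  simp only [cutSet, Finset.mem_insert, Finset.mem_filter] at hr
  rcases hr with rfl | hr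
  · simp [orient]
  · exact hr.2.le

lemma orient_nonpos_of_notMem_cutSet {P : Finset (ℝ × ℝ)} {p q r : ℝ × ℝ} (hrP : r ∈ P)
    (hr : r ∉ cutSet P (p, q)) : orient p q r ≤ 0 := by
  simp only [cutSet, Finset.mem_insert, Finset.mem_filter, not_or, not_and, not_lt] at hr
  exact hr.2 hrP

lemma notMem_cutSet {P : Finset (ℝ × ℝ)} {p q : ℝ × ℝ} (hpq : p ≠ q) : q ∉ cutSet P (p, q) := by
  simp only [cutSet, Finset.mem_insert, Finset.mem_filter, not_or, not_and, not_lt]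
  exact ⟨hpq.symm, fun _ => by simp only [orient]; linarith⟩

lemma GenPos.cutSet_injOn {P : Finset (ℝ × ℝ)} (h : GenPos P) :
    Set.InjOn (cutSet P) (P.offDiag : Set ((ℝ × ℝ) × (ℝ × ℝ))) := by
  rintro ⟨p, q⟩ hx ⟨p', q'⟩ hx' he
  simp only [Finset.coe_offDiag, Set.mem_offDiag, Finset.mem_coe] at hx hx'
  obtain ⟨hp, hq, hpq⟩ := hx
  obtain ⟨hp', hq', hpq'⟩ := hx'
  have m1 : p' ∈ cutSet P (p, q) := by rw [he]; simp [cutSet]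
  have m2 : p ∈ cutSet P (p', q') := by rw [← he]; simp [cutSet]
  have m3 : q' ∉ cutSet P (p, q) := by rw [he]; exact notMem_cutSet hpq'
  have m4 : q ∉ cutSet P (p', q') := by rw [← he]; exact notMem_cutSet hpq
  have e1 := orient_nonneg_of_mem_cutSet m1
  have e2 := orient_nonneg_of_mem_cutSet m2
  have e3 := orient_nonpos_of_notMem_cutSet hq' m3
  have e4 := orient_nonpos_of_notMem_cutSet hq m4
  have s1 : orient p q q' - orient p q p' = -(orient p' q' q - orient p' q' p) := by
    unfold orient; ring
  have z1 : orient p q p' = 0 := by linarith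
  have z2 : orient p q q' = 0 := by linarith
  have hpp : p' = p := by
    simp only [cutSet, Finset.mem_insert, Finset.mem_filter] at m1
    rcases m1 with m1 | m1
    · exact m1
    · exact absurd z1 m1.2.ne'
  have hqq : q' = q := by
    by_contra hne
    exact h.orient_ne_zero hp hq hq' hpq (hpp ▸ hpq') (Ne.symm hne) z2
  rw [hpp, hqq]

lemma GenPos.exists_halfplane_cutSet {P : Finset (ℝ × ℝ)} (h : GenPos P) {p q : ℝ × ℝ}
    (hp : p ∈ P) (hq : q ∈ P) (hpq : p ≠ q) :
    ∃ v : ℝ × ℝ, v ≠ 0 ∧ ∃ a : ℝ, ∀ r ∈ P, (r ∈ cutSet P (p, q) ↔ dot r v < a) := by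
  set d : ℝ := (q.1 - p.1) ^ 2 + (q.2 - p.2) ^ 2 with hd
  have hd0 : 0 < d := sq_add_sq_pos_of_ne_zero (sub_ne_zero.2 hpq.symm)
  let g : ℝ × ℝ → ℝ := fun r => (r.1 - p.1) * (q.1 - p.1) + (r.2 - p.2) * (q.2 - p.2) - d / 2
  have hev : ∀ᶠ ε : ℝ in 𝓝[>] 0, ∀ r ∈ P,
      (r ∈ cutSet P (p, q) ↔ -orient p q r + ε * g r < 0) := by
    rw [Filter.eventually_all_finset]
    intro r hr
    have hc : Tendsto (fun ε : ℝ => -orient p q r + ε * g r) (𝓝[>] 0) (𝓝 (-orient p q r)) := by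
      have : Continuous fun ε : ℝ => -orient p q r + ε * g r := by fun_prop
      simpa using (this.tendsto 0).mono_left nhdsWithin_le_nhds
    by_cases hrp : r = p
    · filter_upwards [self_mem_nhdsWithin] with ε hε
      have hε : 0 < ε := hε
      have : orient p q p = 0 := by simp [orient]
      have hg : g p = -(d / 2) := by simp [g]
      rw [hrp, this, hg]
      simp only [cutSet, Finset.mem_insert, true_or, true_iff]
      nlinarith
    by_cases hrq : r = q
    · filter_upwards [self_mem_nhdsWithin] with ε hε
      have hε : 0 < ε := hε
      have : orient p q q = 0 := by simp only [orient]; ring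
      have hg : g q = d / 2 := by simp only [g, hd]; ring
      rw [hrq, this, hg]
      simp only [notMem_cutSet hpq, false_iff, not_lt]
      nlinarith
    have hne := h.orient_ne_zero hp hq hr hpq (Ne.symm hrp) (Ne.symm hrq)
    rcases lt_or_gt_of_ne hne with h0 | h0
    · filter_upwards [hc.eventually_const_lt (show 0 < -orient p q r by linarith)] with ε hε
      simp only [cutSet, Finset.mem_insert, hrp, Finset.mem_filter, false_or]
      constructor <;> intro hh
      · linarith [hh.2]
      · linarith
    · filter_upwards [hc.eventually_lt_const (show -orient p q r < 0 by linarith)] with ε hε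
      simp only [cutSet, Finset.mem_insert, hrp, Finset.mem_filter, false_or]
      exact ⟨fun _ => hε, fun _ => ⟨hr, h0⟩⟩
  obtain ⟨ε, hε⟩ := hev.exists
  let v : ℝ × ℝ := ((q.2 - p.2) + ε * (q.1 - p.1), -(q.1 - p.1) + ε * (q.2 - p.2))
  have hv : ∀ r : ℝ × ℝ, -orient p q r + ε * g r = dot r v - (dot p v + ε * (d / 2)) := by
    intro r; simp only [orient, g, dot, v]; ring
  have hiff : ∀ r ∈ P, (r ∈ cutSet P (p, q) ↔ dot r v < dot p v + ε * (d / 2)) := by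
    intro r hr
    rw [hε r hr, hv, sub_neg]
  refine ⟨v, ?_, _, hiff⟩
  intro hv0
  have h1 := (hiff p hp).1 (by simp [cutSet])
  have h2 := mt (hiff q hq).2 (notMem_cutSet hpq)
  rw [hv0] at h1 h2
  simp only [dot, Prod.fst_zero, Prod.snd_zero, mul_zero, add_zero, zero_add] at h1 h2
  exact h2 h1

lemma GenPos.card_filter_leftCount_le_chiLe {P : Finset (ℝ × ℝ)} (h : GenPos P) (k : ℕ) :
    (P.offDiag.filter fun x => leftCount P x.1 x.2 < k).card ≤ chiLe P k := by
  have hsub : P.offDiag.filter (fun x => leftCount P x.1 x.2 < k) ⊆ P.offDiag :=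
    Finset.filter_subset _ _
  rw [← Finset.card_image_of_injOn (h.cutSet_injOn.mono (Finset.coe_subset.2 hsub)),
    ← Set.ncard_coe_finset, chiLe]
  apply Set.ncard_le_ncard
  · rintro S hS
    simp only [Finset.coe_image, Set.mem_image, Finset.mem_coe, Finset.mem_filter,
      Finset.mem_offDiag] at hS
    obtain ⟨⟨p, q⟩, ⟨⟨hp, hq, hpq⟩, hl⟩, rfl⟩ := hS
    refine ⟨⟨p, by simp [cutSet]⟩, ?_, ?_, h.exists_halfplane_cutSet hp hq hpq⟩
    · exact (Finset.card_insert_le _ _).trans hl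
    · exact Finset.insert_subset hp (Finset.filter_subset _ _)
  · exact (Finset.finite_toSet P.powerset).subset fun S hS => by
      simpa using hS.2.2.1

lemma GenPos.sum_noncentral_le_chiLe {P : Finset (ℝ × ℝ)} (h : GenPos P) (k : ℕ) :
    ∑ x ∈ P.offDiag, (1 - central P k x.1 x.2) ≤ 2 * (chiLe P k : ℤ) := by
  have hM := h.card_filter_leftCount_le_chiLe k
  have h1 : ∑ x ∈ P.offDiag, (if leftCount P x.1 x.2 < k then 1 else 0 : ℤ) ≤ chiLe P k := by
    rw [← Finset.sum_filter]; simpa using hM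
  have h2 : ∑ x ∈ P.offDiag, (if leftCount P x.2 x.1 < k then 1 else 0 : ℤ) =
      ∑ x ∈ P.offDiag, (if leftCount P x.1 x.2 < k then 1 else 0 : ℤ) := by
    apply Finset.sum_nbij' Prod.swap Prod.swap <;> simp +contextual [eq_comm]
  have h3 : ∑ x ∈ P.offDiag, (1 - central P k x.1 x.2) ≤
      ∑ x ∈ P.offDiag, ((if leftCount P x.1 x.2 < k then 1 else 0 : ℤ) +
        (if leftCount P x.2 x.1 < k then 1 else 0 : ℤ)) := by
    apply Finset.sum_le_sum
    intro x _
    unfold central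
    split_ifs <;> omega
  rw [Finset.sum_add_distrib, h2] at h3
  linarith

/-! ### Central pairs across a line -/

lemma sum_telescope {ι : Type*} [DecidableEq ι] (t : ι → ℝ) (sg : ι → ℤ) (Φ : ℤ → ℤ) (b : ℤ)
    (S : Finset ι) : Set.InjOn t S →
    ∑ x ∈ S, (Φ (b + ∑ y ∈ S, (if t y < t x then sg y else 0) + sg x) -
      Φ (b + ∑ y ∈ S, if t y < t x then sg y else 0)) = Φ (b + ∑ y ∈ S, sg y) - Φ b := by
  induction S using Finset.induction_on_max_value t with
  | empty => simp
  | insert a s ha hmax ih =>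
    intro hinj
    have hlt : ∀ x ∈ s, t x < t a := fun x hx =>
      lt_of_le_of_ne (hmax x hx) fun he => ha (by
        have := hinj (by simp [hx]) (by simp) he
        exact this ▸ hx)
    have ih' := ih (hinj.mono (by simp))
    rw [Finset.sum_insert ha]
    have e1 : ∑ y ∈ insert a s, (if t y < t a then sg y else 0) = ∑ y ∈ s, sg y := by
      rw [Finset.sum_insert ha, if_neg (lt_irrefl _), zero_add]
      exact Finset.sum_congr rfl fun y hy => if_pos (hlt y hy)
    have e2 : ∀ x ∈ s, ∑ y ∈ insert a s, (if t y < t x then sg y else 0) =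
        ∑ y ∈ s, (if t y < t x then sg y else 0) := by
      intro x hx
      rw [Finset.sum_insert ha, if_neg (not_lt.2 (hmax x hx)), zero_add]
    have e3 : ∑ x ∈ s, (Φ (b + ∑ y ∈ insert a s, (if t y < t x then sg y else 0) + sg x) -
        Φ (b + ∑ y ∈ insert a s, if t y < t x then sg y else 0)) =
        ∑ x ∈ s, (Φ (b + ∑ y ∈ s, (if t y < t x then sg y else 0) + sg x) -
        Φ (b + ∑ y ∈ s, if t y < t x then sg y else 0)) :=
      Finset.sum_congr rfl fun x hx => by rw [e2 x hx]
    rw [e1, e3, ih', Finset.sum_insert ha]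
    rw [show b + (sg a + ∑ y ∈ s, sg y) = b + ∑ y ∈ s, sg y + sg a by ring]
    ring

/-- `central`, signed by the order of the two points in direction `u`. -/
noncomputable def signedCentral (P : Finset (ℝ × ℝ)) (k : ℕ) (u a x : ℝ × ℝ) : ℤ :=
  ((if dot a u < dot x u then 1 else 0) - if dot x u < dot a u then 1 else 0) * central P k a x

lemma GenPos.sum_signedCentral_le {P : Finset (ℝ × ℝ)} (h : GenPos P) {k : ℕ}
    (hk2 : 2 * k < P.card) {u : ℝ × ℝ} (hu : Set.InjOn (dot · u) P) {a : ℝ × ℝ} (ha : a ∈ P) :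
    ∑ x ∈ P, signedCentral P k u a x ≤ (P.card : ℤ) - 1 - 2 * k := by
  rw [← Finset.sum_erase P (a := a) (by simp [signedCentral])]
  set S := P.erase a with hS
  have hX : ∀ x ∈ S, dot x u ≠ dot a u := fun x hx he => by
    rw [hS, Finset.mem_erase] at hx
    exact hx.1 (hu hx.2 ha he)
  by_cases hS0 : S = ∅
  · rw [hS0]; simp; omega
  have hu0 : 0 < u.1 ^ 2 + u.2 ^ 2 := by
    obtain ⟨x, hx⟩ := Finset.nonempty_iff_ne_empty.2 hS0
    exact sq_add_sq_pos_of_ne_zero fun h0 => hX x hx (by simp [dot, h0])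
  let t : ℝ × ℝ → ℝ := fun x =>
    (dot x (-u.2, u.1) - dot a (-u.2, u.1)) / (dot x u - dot a u)
  have hor : ∀ x ∈ S, ∀ y ∈ S, orient x a y * (u.1 ^ 2 + u.2 ^ 2) =
      (dot x u - dot a u) * (dot y u - dot a u) * (t x - t y) := by
    intro x hx y hy
    have h1 := sub_ne_zero.2 (hX x hx)
    have h2 := sub_ne_zero.2 (hX y hy)
    have e : (dot x u - dot a u) * (dot y u - dot a u) * (t x - t y) =
      (dot x (-u.2, u.1) - dot a (-u.2, u.1)) * (dot y u - dot a u) -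
      (dot x u - dot a u) * (dot y (-u.2, u.1) - dot a (-u.2, u.1)) := by
      simp only [t]; field_simp
    rw [e]
    simp only [orient, dot]; ring
  have hinj : Set.InjOn t S := by
    intro x hx y hy he
    by_contra hxy
    have h1 := hor x hx y hy
    rw [he, sub_self, mul_zero] at h1
    have hx' := Finset.mem_erase.1 hx
    have hy' := Finset.mem_erase.1 hy
    rcases mul_eq_zero.1 h1 with h1 | h1
    · exact h.orient_ne_zero hx'.2 ha hy'.2 hx'.1 hxy (Ne.symm hy'.1) h1
    · exact hu0.ne' h1
  let sg : ℝ × ℝ → ℤ := fun x =>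
    (if dot a u < dot x u then 1 else 0) - if dot x u < dot a u then 1 else 0
  let Φ : ℤ → ℤ := fun z => max k (min ((P.card : ℤ) - 1 - k) z)
  have htel := sum_telescope t sg Φ (∑ y ∈ S, if dot y u < dot a u then 1 else 0) S hinj
  have hcount : ∀ p q : ℝ × ℝ, (p = a ∨ q = a) →
      (leftCount P p q : ℤ) = ∑ y ∈ S, if 0 < orient p q y then 1 else 0 := by
    intro p q hpq
    rw [leftCount, ← Finset.sum_boole, hS, Finset.sum_erase]
    have : orient p q a = 0 := by
      rcases hpq with rfl | rfl <;> simp only [orient] <;> ring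
    simp [this]
  have hpos : ∀ x ∈ S, ∀ y ∈ S, (0 < orient x a y ↔
      0 < (dot x u - dot a u) * (dot y u - dot a u) * (t x - t y)) := by
    intro x hx y hy
    rw [← hor x hx y hy]
    exact (mul_pos_iff_of_pos_right hu0).symm
  have hpos' : ∀ x ∈ S, ∀ y ∈ S, (0 < orient a x y ↔
      0 < -((dot x u - dot a u) * (dot y u - dot a u) * (t x - t y))) := by
    intro x hx y hy
    rw [← hor x hx y hy, orient_swap x a, ← neg_mul]
    exact (mul_pos_iff_of_pos_right hu0).symm
  have hstep : ∀ x ∈ S, signedCentral P k u a x =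
      Φ (∑ y ∈ S, (if dot y u < dot a u then 1 else 0) +
        ∑ y ∈ S, (if t y < t x then sg y else 0) + sg x) -
      Φ (∑ y ∈ S, (if dot y u < dot a u then 1 else 0) +
        ∑ y ∈ S, if t y < t x then sg y else 0) := by
    intro x hx
    have hx' := Finset.mem_erase.1 hx
    have hl := leftCount_add_leftCount h ha hx'.2 (Ne.symm hx'.1)
    rw [← Finset.sum_add_distrib]
    rcases lt_or_gt_of_ne (hX x hx) with hlt | hlt
    · have e : ∑ y ∈ S, ((if dot y u < dot a u then 1 else 0) +
          (if t y < t x then sg y else 0)) = (leftCount P a x : ℤ) + 1 := by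
        rw [hcount a x (Or.inl rfl)]
        have hone : ∑ y ∈ S, ((if 0 < orient a x y then 1 else 0 : ℤ) + if y = x then 1 else 0) =
            (∑ y ∈ S, if 0 < orient a x y then 1 else 0) + 1 := by
          rw [Finset.sum_add_distrib]; simp [hx]
        rw [← hone]
        apply Finset.sum_congr rfl
        intro y hy
        simp only [hpos' x hx y hy]
        have h1 : dot x u - dot a u < 0 := by linarith
        by_cases hyx : y = x
        · subst hyx; simp [hlt]
        have htne : t y ≠ t x := fun he => hyx (hinj hy hx he)
        rcases lt_or_gt_of_ne (hX y hy) with h2 | h2 <;> rcases lt_or_gt_of_ne htne with h3 | h3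
        · have : ¬ 0 < -((dot x u - dot a u) * (dot y u - dot a u) * (t x - t y)) := by
            have := mul_pos (mul_pos_of_neg_of_neg h1 (sub_neg.2 h2)) (sub_pos.2 h3)
            linarith
          simp [sg, this, hyx, h2, h3, not_lt.2 h2.le]
        · have : 0 < -((dot x u - dot a u) * (dot y u - dot a u) * (t x - t y)) := by
            have := mul_neg_of_pos_of_neg (mul_pos_of_neg_of_neg h1 (sub_neg.2 h2)) (sub_neg.2 h3)
            linarith
          simp only [this, hyx, h2, not_lt.2 h3.le, if_true, if_false]
        · have : 0 < -((dot x u - dot a u) * (dot y u - dot a u) * (t x - t y)) := by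
            have := mul_neg_of_neg_of_pos (mul_neg_of_neg_of_pos h1 (sub_pos.2 h2)) (sub_pos.2 h3)
            linarith
          simp only [sg, this, hyx, h2, h3, not_lt.2 h2.le, if_true, if_false]
          norm_num
        · have : ¬ 0 < -((dot x u - dot a u) * (dot y u - dot a u) * (t x - t y)) := by
            have := mul_pos_of_neg_of_neg (mul_neg_of_neg_of_pos h1 (sub_pos.2 h2)) (sub_neg.2 h3)
            linarith
          simp only [this, hyx, not_lt.2 h2.le, not_lt.2 h3.le, if_false]
      rw [e]
      have hsg : sg x = -1 := by simp [sg, hlt, not_lt.2 hlt.le]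
      have : signedCentral P k u a x = -central P k a x := by
        simp [signedCentral, hlt, not_lt.2 hlt.le]
      rw [this, hsg]
      simp only [Φ, central]
      split_ifs <;> omega
    · have e : ∑ y ∈ S, ((if dot y u < dot a u then 1 else 0) +
          (if t y < t x then sg y else 0)) = (leftCount P x a : ℤ) := by
        rw [hcount x a (Or.inr rfl)]
        apply Finset.sum_congr rfl
        intro y hy
        simp only [hpos x hx y hy]
        have h1 : 0 < dot x u - dot a u := by linarith
        by_cases hyx : y = x
        · subst hyx; simp [not_lt.2 (le_of_lt hlt)]
        have htne : t y ≠ t x := fun he => hyx (hinj hy hx he)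
        rcases lt_or_gt_of_ne (hX y hy) with h2 | h2 <;> rcases lt_or_gt_of_ne htne with h3 | h3
        · have : ¬ 0 < (dot x u - dot a u) * (dot y u - dot a u) * (t x - t y) := by
            have := mul_neg_of_neg_of_pos (mul_neg_of_pos_of_neg h1 (sub_neg.2 h2)) (sub_pos.2 h3)
            linarith
          simp only [sg, this, h2, h3, not_lt.2 h2.le, if_true, if_false]
          norm_num
        · have : 0 < (dot x u - dot a u) * (dot y u - dot a u) * (t x - t y) :=
            mul_pos_of_neg_of_neg (mul_neg_of_pos_of_neg h1 (sub_neg.2 h2)) (sub_neg.2 h3)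
          simp only [this, h2, not_lt.2 h3.le, if_true, if_false]
          norm_num
        · have : 0 < (dot x u - dot a u) * (dot y u - dot a u) * (t x - t y) :=
            mul_pos (mul_pos h1 (sub_pos.2 h2)) (sub_pos.2 h3)
          simp only [sg, this, h2, h3, not_lt.2 h2.le, if_true, if_false]
          norm_num
        · have : ¬ 0 < (dot x u - dot a u) * (dot y u - dot a u) * (t x - t y) := by
            have := mul_neg_of_pos_of_neg (mul_pos h1 (sub_pos.2 h2)) (sub_neg.2 h3)
            linarith
          simp only [this, not_lt.2 h2.le, not_lt.2 h3.le, if_false]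
          norm_num
      rw [e]
      have hsg : sg x = 1 := by simp [sg, hlt, not_lt.2 (le_of_lt hlt)]
      have : signedCentral P k u a x = central P k a x := by
        simp [signedCentral, hlt, not_lt.2 (le_of_lt hlt)]
      rw [this, hsg]
      simp only [Φ, central]
      split_ifs <;> omega
  rw [Finset.sum_congr rfl hstep, htel]
  simp only [Φ]
  omega

/-- `T` is an initial segment of `P` in direction `u`. -/
def IsInitial (P : Finset (ℝ × ℝ)) (u : ℝ × ℝ) (T : Finset (ℝ × ℝ)) : Prop :=
  T ⊆ P ∧ ∀ t ∈ T, ∀ s ∈ P \ T, dot t u < dot s u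

lemma GenPos.sum_central_sdiff_le {P : Finset (ℝ × ℝ)} (h : GenPos P) {k : ℕ}
    (hk2 : 2 * k < P.card) {u : ℝ × ℝ} (hu : Set.InjOn (dot · u) P) {T : Finset (ℝ × ℝ)}
    (hT : IsInitial P u T) :
    ∑ p ∈ T, ∑ q ∈ P \ T, central P k p q ≤ T.card * ((P.card : ℤ) - 1 - 2 * k) := by
  have h1 : ∑ p ∈ T, ∑ q ∈ P, signedCentral P k u p q ≤
      T.card * ((P.card : ℤ) - 1 - 2 * k) := by
    rw [← nsmul_eq_mul]
    exact Finset.sum_le_card_nsmul _ _ _ fun p hp => h.sum_signedCentral_le hk2 hu (hT.1 hp)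
  have h2 : ∑ p ∈ T, ∑ q ∈ T, signedCentral P k u p q = 0 := by
    have hanti : ∀ p q, signedCentral P k u p q = -signedCentral P k u q p := by
      intro p q
      simp only [signedCentral, central_comm P k q p]; ring
    have : ∑ p ∈ T, ∑ q ∈ T, signedCentral P k u p q =
        -∑ p ∈ T, ∑ q ∈ T, signedCentral P k u p q := by
      conv_lhs => rw [Finset.sum_comm]
      simp only [← Finset.sum_neg_distrib]
      exact Finset.sum_congr rfl fun p _ => Finset.sum_congr rfl fun q _ => hanti q p
    omega
  have h3 : ∑ p ∈ T, ∑ q ∈ P, signedCentral P k u p q =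
      ∑ p ∈ T, ∑ q ∈ P \ T, central P k p q + ∑ p ∈ T, ∑ q ∈ T, signedCentral P k u p q := by
    rw [← Finset.sum_add_distrib]
    apply Finset.sum_congr rfl
    intro p hp
    rw [← Finset.sum_sdiff hT.1]
    congr 1
    apply Finset.sum_congr rfl
    intro q hq
    have := hT.2 p hp q hq
    simp [signedCentral, this, not_lt.2 this.le]
  linarith

lemma IsInitial.exists_subset {P : Finset (ℝ × ℝ)} {u : ℝ × ℝ} (hu : Set.InjOn (dot · u) P)
    (w j : ℕ) {T : Finset (ℝ × ℝ)} (hT : IsInitial P u T) (hc : T.card = w + j) :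
    ∃ T' ⊆ T, IsInitial P u T' ∧ T'.card = w := by
  induction j generalizing T with
  | zero => exact ⟨T, subset_rfl, hT, hc⟩
  | succ j ih =>
    obtain ⟨x, hx, hmax⟩ := Finset.exists_max_image T (dot · u)
      (Finset.card_pos.1 (by omega))
    have hI : IsInitial P u (T.erase x) := by
      refine ⟨(Finset.erase_subset _ _).trans hT.1, ?_⟩
      intro t ht s hs
      rw [Finset.mem_erase] at ht
      rw [Finset.mem_sdiff, Finset.mem_erase] at hs
      by_cases hsT : s ∈ T
      · have hsx : s = x := by by_contra hne; exact hs.2 ⟨hne, hsT⟩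
        subst hsx
        exact lt_of_le_of_ne (hmax t ht.2) fun he => ht.1 (hu (hT.1 ht.2) hs.1 he)
      · exact hT.2 t ht.2 s (Finset.mem_sdiff.2 ⟨hs.1, hsT⟩)
    obtain ⟨T', hT', hI', hc'⟩ := ih hI (by rw [Finset.card_erase_of_mem hx]; omega)
    exact ⟨T', hT'.trans (Finset.erase_subset _ _), hI', hc'⟩

lemma exists_generic_direction (P : Finset (ℝ × ℝ)) {A : Finset (ℝ × ℝ)} {u : ℝ × ℝ}
    (hu : u ≠ 0) (hA : IsInitial P u A) :
    ∃ u' : ℝ × ℝ, Set.InjOn (dot · u') P ∧ IsInitial P u' A := by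
  let w : ℝ → ℝ × ℝ := fun ε => (u.1 - ε * u.2, u.2 + ε * u.1)
  have hc : ∀ p q : ℝ × ℝ, Tendsto (fun ε => dot q (w ε) - dot p (w ε)) (𝓝[>] 0)
      (𝓝 (dot q u - dot p u)) := by
    intro p q
    have : Continuous fun ε => dot q (w ε) - dot p (w ε) := by
      simp only [dot, w]; fun_prop
    have := (this.tendsto 0).mono_left (nhdsWithin_le_nhds (s := Set.Ioi (0 : ℝ)))
    simpa [w] using this
  have hlt : ∀ p q : ℝ × ℝ, dot p u < dot q u →
      ∀ᶠ ε in 𝓝[>] (0 : ℝ), dot p (w ε) < dot q (w ε) := by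
    intro p q hpq
    filter_upwards [(hc p q).eventually_const_lt (sub_pos.2 hpq)] with ε hε
    exact sub_pos.1 hε
  have h1 : ∀ᶠ ε in 𝓝[>] (0 : ℝ), ∀ p ∈ P, ∀ q ∈ P, dot p (w ε) = dot q (w ε) → p = q := by
    simp only [Filter.eventually_all_finset]
    intro p _ q _
    rcases lt_trichotomy (dot p u) (dot q u) with h | h | h
    · filter_upwards [hlt p q h] with ε hε he
      exact absurd he hε.ne
    · filter_upwards [self_mem_nhdsWithin] with ε hε he
      have hε : 0 < ε := hε
      simp only [dot, w] at h he
      have e1 : (p.1 - q.1) * u.1 + (p.2 - q.2) * u.2 = 0 := by linarith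
      have e2 : (p.2 - q.2) * u.1 - (p.1 - q.1) * u.2 = 0 := by
        have : ε * ((p.2 - q.2) * u.1 - (p.1 - q.1) * u.2) = 0 := by linarith
        exact (mul_eq_zero.1 this).resolve_left hε.ne'
      have hu0 : u.1 ^ 2 + u.2 ^ 2 ≠ 0 := (sq_add_sq_pos_of_ne_zero hu).ne'
      have e3 : (p.1 - q.1) * (u.1 ^ 2 + u.2 ^ 2) = 0 := by
        linear_combination u.1 * e1 - u.2 * e2
      have e4 : (p.2 - q.2) * (u.1 ^ 2 + u.2 ^ 2) = 0 := by
        linear_combination u.2 * e1 + u.1 * e2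
      exact Prod.ext (sub_eq_zero.1 ((mul_eq_zero.1 e3).resolve_right hu0))
        (sub_eq_zero.1 ((mul_eq_zero.1 e4).resolve_right hu0))
    · filter_upwards [hlt q p h] with ε hε he
      exact absurd he hε.ne'
  have h2 : ∀ᶠ ε in 𝓝[>] (0 : ℝ), ∀ p ∈ A, ∀ q ∈ P \ A, dot p (w ε) < dot q (w ε) := by
    simp only [Filter.eventually_all_finset]
    exact fun p hp q hq => hlt p q (hA.2 p hp q hq)
  obtain ⟨ε, hε1, hε2⟩ := (h1.and h2).exists
  exact ⟨w ε, fun p hp q hq he => hε1 p hp q hq he, hA.1, hε2⟩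

/-! ### Central pairs inside an initial segment -/

lemma GenPos.sum_central_le_of_subset {P : Finset (ℝ × ℝ)} (h : GenPos P) {k : ℕ}
    (hk1 : 1 ≤ k) (hk2 : 2 * k < P.card) {u : ℝ × ℝ} (hu : Set.InjOn (dot · u) P)
    {T T' : Finset (ℝ × ℝ)} (hT : T ⊆ P) (hT' : IsInitial P u T') (hsub : T' ⊆ T) :
    ∑ p ∈ T, ∑ q ∈ T, central P k p q ≤ ∑ p ∈ T', ∑ q ∈ T', central P k p q +
      2 * (T'.card * ((P.card : ℤ) - 1 - 2 * k)) +
      ((T.card : ℤ) - T'.card) * ((T.card : ℤ) - T'.card - 1) := by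
  set U := T \ T' with hU
  have hcard : (U.card : ℤ) = T.card - T'.card := by
    rw [hU, Finset.card_sdiff_of_subset hsub, Nat.cast_sub (Finset.card_le_card hsub)]
  have hsplit : ∀ f : ℝ × ℝ → ℤ, ∑ q ∈ T, f q = ∑ q ∈ U, f q + ∑ q ∈ T', f q :=
    fun f => (Finset.sum_sdiff hsub).symm
  have h1 : ∑ p ∈ T', ∑ q ∈ U, central P k p q ≤ T'.card * ((P.card : ℤ) - 1 - 2 * k) := by
    refine le_trans ?_ (h.sum_central_sdiff_le hk2 hu hT')
    apply Finset.sum_le_sum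
    intro p _
    exact Finset.sum_le_sum_of_subset_of_nonneg (Finset.sdiff_subset_sdiff hT subset_rfl)
      fun q _ _ => central_nonneg P k p q
  have h2 : ∑ p ∈ U, ∑ q ∈ T', central P k p q = ∑ p ∈ T', ∑ q ∈ U, central P k p q := by
    rw [Finset.sum_comm]
    exact Finset.sum_congr rfl fun p _ => Finset.sum_congr rfl fun q _ => central_comm P k q p
  have h3 : ∑ p ∈ U, ∑ q ∈ U, central P k p q ≤ U.card * ((U.card : ℤ) - 1) := by
    rw [← nsmul_eq_mul]
    apply Finset.sum_le_card_nsmul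
    intro p hp
    rw [← Finset.sum_erase U (central_self P hk1 p)]
    have hle := Finset.sum_le_card_nsmul (U.erase p) (fun q => central P k p q) 1
      fun q _ => central_le_one P k p q
    have hc := Finset.card_erase_add_one hp
    simp only [nsmul_eq_mul, mul_one] at hle
    omega
  rw [hsplit]
  simp only [hsplit, Finset.sum_add_distrib]
  rw [hcard] at h3
  rw [h2]
  linarith

lemma GenPos.sum_central_initial_le {P : Finset (ℝ × ℝ)} (h : GenPos P) {k : ℕ}
    (hk1 : 1 ≤ k) (hk2 : 2 * k < P.card) {u : ℝ × ℝ} (hu : Set.InjOn (dot · u) P) {m : ℤ}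
    (hm : m = (P.card : ℤ) - 1 - 2 * k) (s : ℕ) {T : Finset (ℝ × ℝ)} (hT : IsInitial P u T)
    {q ρ : ℤ} (hρ0 : 0 ≤ ρ) (hρ : ρ ≤ s + 1) (hq : m * s ≤ q)
    (hv : 2 * (T.card : ℤ) + m * (s * (s + 1)) = 2 * ((s + 1) * q + ρ)) :
    6 * ∑ p ∈ T, ∑ q ∈ T, central P k p q ≤
      -6 * T.card + 6 * (s + 1) * q ^ 2 + 6 * ρ * (2 * q + 1) -
        m ^ 2 * (s * (s + 1) * (2 * s + 1)) := by
  have hm0 : 0 ≤ m := by omega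
  induction s generalizing T q ρ with
  | zero =>
    have h0 := h.sum_central_le_of_subset hk1 hk2 hu (T := T) (T' := ∅) hT.1
      ⟨by simp, by simp⟩ (by simp)
    simp only [Finset.sum_empty, Finset.card_empty] at h0
    have hv' : (T.card : ℤ) = q + ρ := by push_cast at hv; linarith
    have hρρ : ρ * (ρ - 1) = 0 := by
      have : ρ = 0 ∨ ρ = 1 := by push_cast at hρ; omega
      rcases this with rfl | rfl <;> rfl
    push_cast at h0 ⊢
    rw [hv'] at h0 ⊢
    nlinarith
  | succ s ih =>
    have main : ∀ {q ρ : ℤ}, 0 ≤ ρ → ρ ≤ s + 1 → m * (s + 1) ≤ q →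
        2 * (T.card : ℤ) + m * ((s + 1) * (s + 2)) = 2 * ((s + 2) * q + ρ) →
        6 * ∑ p ∈ T, ∑ q ∈ T, central P k p q ≤
          -6 * T.card + 6 * (s + 2) * q ^ 2 + 6 * ρ * (2 * q + 1) -
            m ^ 2 * ((s + 1) * (s + 2) * (2 * s + 3)) := by
      intro q ρ hρ0 hρ hq hv
      have hq' : m * s ≤ q - m := by linarith
      have hq0 : 0 ≤ q := le_trans (by positivity) hq
      have hv' : 2 * ((T.card : ℤ) - q) + m * (s * (s + 1)) = 2 * ((s + 1) * (q - m) + ρ) := by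
        linear_combination hv
      have hnn : 0 ≤ (T.card : ℤ) - q := by
        have h1 : (s + 1 : ℤ) * (m * s) ≤ (s + 1) * (q - m) :=
          mul_le_mul_of_nonneg_left hq' (by positivity)
        have h2 : 0 ≤ m * (s * (s + 1) : ℤ) := by positivity
        nlinarith
      obtain ⟨w, hw⟩ := Int.eq_ofNat_of_zero_le hnn
      obtain ⟨j, hj⟩ := Int.eq_ofNat_of_zero_le hq0
      obtain ⟨T', hsub, hI, hc⟩ := hT.exists_subset hu w j (by omega)
      have h1 := ih hI hρ0 hρ hq' (by rw [hc, ← hw]; exact hv')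
      have h2 := h.sum_central_le_of_subset hk1 hk2 hu hT.1 hI hsub
      rw [← hm] at h2
      rw [hc, ← hw] at h1 h2
      have hT2 : (T.card : ℤ) * 2 = 2 * ((s + 2) * q + ρ) - m * ((s + 1) * (s + 2)) := by
        linear_combination hv
      have key : 6 * ((T.card : ℤ) - q) * m * 2 = 6 * m * (2 * ((s + 2) * q + ρ) -
        m * ((s + 1) * (s + 2)) - 2 * q) := by
        rw [← hT2]; ring
      linarith
    push_cast at hρ hq hv ⊢
    rcases hρ.lt_or_eq with hlt | heq
    · have := main (q := q) (ρ := ρ) hρ0 (by omega) hq (by linear_combination hv)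
      linarith
    · have hq1 : m * (s + 1) ≤ q + 1 := by linarith
      have := main (q := q + 1) (ρ := 0) le_rfl (by positivity) hq1
        (by rw [heq] at hv; linear_combination hv)
      rw [heq]
      linarith

/-! ### Noncentral pairs starting in an initial segment -/

lemma sum_offDiag_noncentral (P : Finset (ℝ × ℝ)) (k : ℕ) :
    ∑ x ∈ P.offDiag, (1 - central P k x.1 x.2) =
      ∑ p ∈ P, ∑ q ∈ P.erase p, (1 - central P k p q) := by
  rw [Finset.sum_sigma']
  refine Finset.sum_bij' (fun x _ => ⟨x.1, x.2⟩) (fun x _ => (x.1, x.2)) ?_ ?_ ?_ ?_ ?_ <;>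
    simp +contextual [eq_comm]

lemma sum_erase_noncentral {P : Finset (ℝ × ℝ)} {k : ℕ} (hk1 : 1 ≤ k) {p : ℝ × ℝ}
    (hp : p ∈ P) : ∑ q ∈ P.erase p, (1 - central P k p q) =
      (P.card : ℤ) - 1 - ∑ q ∈ P, central P k p q := by
  rw [Finset.sum_sub_distrib, Finset.sum_erase P (central_self P hk1 p)]
  have := Finset.card_erase_add_one hp
  simp only [Finset.sum_const, nsmul_eq_mul, mul_one]
  omega

lemma GenPos.noncentral_ge_of_le_card {P : Finset (ℝ × ℝ)} (h : GenPos P) {k : ℕ}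
    (hk2 : 2 * k < P.card) {u : ℝ × ℝ} (hu0 : u ≠ 0)
    {A : Finset (ℝ × ℝ)} (hA : IsInitial P u A) (hkA : k ≤ A.card) :
    (k : ℤ) * (k + 1) ≤ ∑ p ∈ A, ∑ q ∈ P.erase p, (1 - central P k p q) := by
  obtain ⟨u, hu, hA⟩ := exists_generic_direction P hu0 hA
  obtain ⟨T, hTA, hT, hTc⟩ := hA.exists_subset hu k (A.card - k) (by omega)
  have hnn : ∀ p q, 0 ≤ 1 - central P k p q := fun p q => sub_nonneg.2 (central_le_one P k p q)
  have h1 : ∑ p ∈ T, ∑ q ∈ P \ T, (1 - central P k p q) ≤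
      ∑ p ∈ A, ∑ q ∈ P.erase p, (1 - central P k p q) := by
    refine le_trans ?_ (Finset.sum_le_sum_of_subset_of_nonneg hTA
      fun p _ _ => Finset.sum_nonneg fun q _ => hnn p q)
    apply Finset.sum_le_sum
    intro p hp
    apply Finset.sum_le_sum_of_subset_of_nonneg
    · intro q hq
      rw [Finset.mem_sdiff] at hq
      exact Finset.mem_erase.2 ⟨fun he => hq.2 (he ▸ hp), hq.1⟩
    · exact fun q _ _ => hnn p q
  have h2 := h.sum_central_sdiff_le hk2 hu hT
  have hc : ((P \ T).card : ℤ) = P.card - k := by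
    rw [Finset.card_sdiff_of_subset hT.1, Nat.cast_sub (Finset.card_le_card hT.1), hTc]
  simp only [Finset.sum_sub_distrib, Finset.sum_const, nsmul_eq_mul, mul_one, hc, hTc] at h1 h2 ⊢
  linarith

lemma sum_mul_sq_sub_eq (v m : ℝ) (t : ℕ) :
    ∑ j ∈ Finset.range t, ((j : ℝ) + 1) * (j + 2) * (v / ((j + 1) * (j + 2)) - m / 2) ^ 2 =
      v ^ 2 - (v + m * (t * (t + 1) / 2)) ^ 2 / (t + 1) +
        m ^ 2 * (t * (t + 1) * (2 * t + 1)) / 6 := by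
  induction t with
  | zero => simp
  | succ t ih =>
    rw [Finset.sum_range_succ, ih]
    push_cast
    field_simp
    ring

lemma sum_mul_succ_eq (t : ℕ) :
    ∑ j ∈ Finset.range t, ((j : ℝ) + 1) * (j + 2) = t * (t + 1) * (t + 2) / 3 := by
  induction t with
  | zero => simp
  | succ t ih =>
    rw [Finset.sum_range_succ, ih]
    push_cast
    ring

lemma sum_mul_self_sub_one_le {v m t q ρ : ℝ} (S : ℝ) (ht : 1 ≤ t)
    (hH : v + m * (t * (t + 1) / 2) = (t + 1) * q + ρ)
    (hS : S = v ^ 2 - (v + m * (t * (t + 1) / 2)) ^ 2 / (t + 1) +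
        m ^ 2 * (t * (t + 1) * (2 * t + 1)) / 6 - t * (t + 1) * (t + 2) / 12) :
    -v + (t + 1) * q ^ 2 + ρ * (2 * q + 1) - m ^ 2 * (t * (t + 1) * (2 * t + 1)) / 6 ≤
      v * (v - 1) - S := by
  rw [hS, hH]
  have h1 : ((t + 1) * q + ρ) ^ 2 / (t + 1) =
      (t + 1) * q ^ 2 + 2 * q * ρ + ρ ^ 2 / (t + 1) := by
    field_simp; ring
  have h2 : ρ - ρ ^ 2 / (t + 1) ≤ (t + 1) / 4 := by
    rw [sub_le_iff_le_add, ← sub_le_iff_le_add', le_div_iff₀ (by linarith)]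
    nlinarith [sq_nonneg (ρ - (t + 1) / 2)]
  have h3 : (t + 1) / 4 ≤ t * (t + 1) * (t + 2) / 12 := by
    nlinarith [mul_nonneg (show 0 ≤ t + 1 by linarith) (show 0 ≤ t * (t + 2) - 3 by nlinarith)]
  rw [h1]
  linarith

/-- The argument of the `j`-th binomial in `Bkn`, as a function of `v = n / 3` and
`m = n - 1 - 2 * k`. -/
lemma add_one_sub_cseq_mul {k n v m : ℝ} (hn : n = 3 * v) (hm : m = n - 1 - 2 * k) {j : ℕ} :
    k + 1 - cseq (j + 1) * n = v / (((j : ℝ) + 1) * (j + 2)) - m / 2 + 1 / 2 := by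
  rw [cseq, hm, hn]
  push_cast
  field_simp
  ring

lemma rbinom2_nonneg (r : ℝ) : 0 ≤ rbinom2 r := by
  unfold rbinom2
  split_ifs with h
  · have : 0 ≤ r * (r - 1) := mul_nonneg (by linarith) (by linarith)
    linarith
  · exact le_rfl

lemma GenPos.noncentral_ge_of_card_lt {P : Finset (ℝ × ℝ)} (h : GenPos P) {k n v : ℕ}
    (hcard : P.card = n) (hnv : n = 3 * v) (hk1 : 1 ≤ k) (hk2 : 2 * k < n) (s : ℕ)
    {u : ℝ × ℝ} (hu0 : u ≠ 0)
    {A : Finset (ℝ × ℝ)} (hA : IsInitial P u A) (hAv : A.card = v) (hvk : v < k) :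
    (k : ℝ) * (k + 1) - ((k : ℝ) - v) * (k - v + 1) + 2 * (((k : ℝ) - v) * (k - v + 1) +
      ∑ j ∈ Finset.Icc 2 (s - 1), (j : ℝ) * ((j : ℝ) + 1) *
        rbinom2 ((k : ℝ) + 1 - cseq j * (n : ℝ))) ≤
      ((∑ p ∈ A, ∑ q ∈ P.erase p, (1 - central P k p q) : ℤ) : ℝ) := by
  obtain ⟨u, hu, hA⟩ := exists_generic_direction P hu0 hA
  obtain ⟨m, hm⟩ : ∃ m : ℕ, n = m + 1 + 2 * k := ⟨n - 1 - 2 * k, by omega⟩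
  have hmZ : (m : ℤ) = (P.card : ℤ) - 1 - 2 * k := by omega
  have hmR : (m : ℝ) = (n : ℝ) - 1 - 2 * k := by rw [hm]; push_cast; ring
  have hnR : (n : ℝ) = 3 * v := by rw [hnv]; push_cast; ring
  let r : ℕ → ℝ := fun j => (k : ℝ) + 1 - cseq j * n
  let f : ℕ → ℝ := fun j => (j : ℝ) * (j + 1) * rbinom2 (r j)
  have hr : ∀ j, r (j + 1) = v / (((j : ℝ) + 1) * (j + 2)) - m / 2 + 1 / 2 := fun j =>
    add_one_sub_cseq_mul hnR hmR
  have hanti : ∀ i j, i ≤ j → r (j + 1) ≤ r (i + 1) := by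
    intro i j hij
    rw [hr, hr]
    have : (i : ℝ) ≤ j := by exact_mod_cast hij
    gcongr
  have hex : ∃ j, r (j + 1) < 2 := by
    refine ⟨v, ?_⟩
    rw [hr]
    have : (v : ℝ) / ((v + 1) * (v + 2)) ≤ 1 := by
      rw [div_le_one (by positivity)]
      have : (0 : ℝ) ≤ v := by positivity
      nlinarith
    have : (0 : ℝ) ≤ m := by positivity
    linarith
  obtain ⟨t, hrt, hlt⟩ : ∃ t, r (t + 1) < 2 ∧ ∀ j < t, 2 ≤ r (j + 1) :=
    ⟨Nat.find hex, Nat.find_spec hex, fun j hj => not_lt.1 (Nat.find_min hex hj)⟩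
  have hr1 : r 1 = (k : ℝ) - v + 1 := by
    have := hr 0
    rw [zero_add] at this
    rw [this, hmR, hnR]
    push_cast
    ring
  have hvkR : (v : ℝ) + 1 ≤ k := by exact_mod_cast hvk
  have ht1 : 1 ≤ t := by
    by_contra h0
    have : t = 0 := by omega
    rw [this, zero_add, hr1] at hrt
    linarith
  obtain ⟨c, hc⟩ : ∃ c, t * (t + 1) = 2 * c := (Nat.even_mul_succ_self t).two_dvd
  have hmc : m * c ≤ v := by
    have h2 := hlt (t - 1) (by omega)
    rw [hr, Nat.cast_sub ht1] at h2
    have htR : (1 : ℝ) ≤ t := by exact_mod_cast ht1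
    have h3 : (m : ℝ) / 2 ≤ v / (((t : ℝ) - (1 : ℕ) + 1) * (t - (1 : ℕ) + 2)) := by linarith
    rw [le_div_iff₀ (by push_cast; nlinarith)] at h3
    have hcR : (t : ℝ) * (t + 1) = 2 * c := by exact_mod_cast hc
    push_cast at h3
    have : (m : ℝ) * c ≤ v := by
      calc (m : ℝ) * c = m / 2 * (2 * c) := by ring
        _ = m / 2 * ((t : ℝ) * (t + 1)) := by rw [hcR]
        _ = m / 2 * (((t : ℝ) - 1 + 1) * (t - 1 + 2)) := by ring
        _ ≤ v := h3
    exact_mod_cast this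
  set q := (v + m * c) / (t + 1) with hq
  set ρ := (v + m * c) % (t + 1) with hρ
  have hdiv : (t + 1) * q + ρ = v + m * c := Nat.div_add_mod _ _
  have hρlt : ρ < t + 1 := Nat.mod_lt _ (by omega)
  have hqm : m * t ≤ q := by
    rw [hq, Nat.le_div_iff_mul_le (by omega), mul_assoc, hc]
    nlinarith
  have hE := h.sum_central_initial_le hk1 (hcard ▸ hk2) hu hmZ t hA (q := q) (ρ := ρ)
    (by positivity) (by exact_mod_cast hρlt.le) (by exact_mod_cast hqm) (by
      have hdivZ : ((t : ℤ) + 1) * q + ρ = v + m * c := by exact_mod_cast hdiv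
      have hcZ : (t : ℤ) * (t + 1) = 2 * c := by exact_mod_cast hc
      rw [hAv, hdivZ, hcZ]; ring)
  have hcross := h.sum_central_sdiff_le (hcard ▸ hk2) hu hA
  have hsum : ∑ p ∈ A, ∑ q ∈ P.erase p, (1 - central P k p q) =
      A.card * ((P.card : ℤ) - 1) - (∑ p ∈ A, ∑ q ∈ P \ A, central P k p q +
        ∑ p ∈ A, ∑ q ∈ A, central P k p q) := by
    rw [Finset.sum_congr rfl fun p hp => sum_erase_noncentral hk1 (hA.1 hp),
      Finset.sum_sub_distrib, Finset.sum_const, nsmul_eq_mul, ← Finset.sum_add_distrib]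
    congr 1
    exact Finset.sum_congr rfl fun p _ => (Finset.sum_sdiff hA.1).symm
  rw [hsum]
  rw [← hmZ] at hcross
  rw [hAv] at hE hcross ⊢
  rw [hcard]
  set E := ∑ p ∈ A, ∑ q ∈ A, central P k p q
  set D := ∑ p ∈ A, ∑ q ∈ P \ A, central P k p q
  have hER : (6 : ℝ) * E ≤ -6 * v + 6 * (t + 1) * (q : ℝ) ^ 2 + 6 * ρ * (2 * q + 1) -
      (m : ℝ) ^ 2 * (t * (t + 1) * (2 * t + 1)) := by exact_mod_cast hE
  have hDR : (D : ℝ) ≤ v * m := by exact_mod_cast hcross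
  have hF : ∑ j ∈ Finset.range t, f (j + 1) = (∑ j ∈ Finset.range t,
      ((j : ℝ) + 1) * (j + 2) * (v / ((j + 1) * (j + 2)) - m / 2) ^ 2 -
      (∑ j ∈ Finset.range t, ((j : ℝ) + 1) * (j + 2)) / 4) / 2 := by
    rw [Finset.sum_div, ← Finset.sum_sub_distrib, Finset.sum_div]
    apply Finset.sum_congr rfl
    intro j hj
    have h2 := hlt j (Finset.mem_range.1 hj)
    simp only [f, rbinom2]
    rw [if_pos h2, hr]
    push_cast
    ring
  rw [sum_mul_sq_sub_eq, sum_mul_succ_eq] at hF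
  have hEF := sum_mul_self_sub_one_le (v := (v : ℝ)) (m := m) (t := t) (q := q) (ρ := ρ)
    (2 * ∑ j ∈ Finset.range t, f (j + 1)) (by exact_mod_cast ht1)
    (by
      have hdivR : ((t : ℝ) + 1) * q + ρ = v + m * c := by exact_mod_cast hdiv
      have hcR : (t : ℝ) * (t + 1) = 2 * c := by exact_mod_cast hc
      rw [hdivR, hcR]; ring)
    (by rw [hF]; ring)
  have hf0 : ∀ j, 0 ≤ f j := fun j => mul_nonneg (by positivity) (rbinom2_nonneg _)
  have hf1 : f 1 = ((k : ℝ) - v) * (k - v + 1) := by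
    simp only [f]
    rw [hr1, rbinom2, if_pos (by linarith)]
    push_cast
    ring
  have hle : f 1 + ∑ j ∈ Finset.Icc 2 (s - 1), f j ≤ ∑ j ∈ Finset.range t, f (j + 1) := by
    have hnot : 1 ∉ Finset.Icc 2 (s - 1) := by simp
    have hz : ∑ j ∈ Finset.range (t + 1), f j = ∑ j ∈ Finset.range t, f (j + 1) := by
      rw [Finset.sum_range_succ']; simp [f]
    rw [← Finset.sum_insert hnot, ← hz]
    have hbig : ∀ j ∈ insert 1 (Finset.Icc 2 (s - 1)),
        j ∉ (insert 1 (Finset.Icc 2 (s - 1))).filter (· ∈ Finset.range (t + 1)) → f j = 0 := by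
      intro j hj hj'
      have : t + 1 ≤ j := by
        by_contra hlt'
        exact hj' (Finset.mem_filter.2 ⟨hj, Finset.mem_range.2 (by omega)⟩)
      obtain ⟨i, rfl⟩ : ∃ i, j = i + 1 := ⟨j - 1, by omega⟩
      have := hanti t i (by omega)
      simp only [f, rbinom2]
      rw [if_neg (by linarith), mul_zero]
    rw [← Finset.sum_subset (Finset.filter_subset _ _) hbig]
    exact Finset.sum_le_sum_of_subset_of_nonneg
      (fun j hj => (Finset.mem_filter.1 hj).2) fun j _ _ => hf0 j
  rw [hf1] at hle
  change _ + 2 * (_ + ∑ j ∈ Finset.Icc 2 (s - 1), f j) ≤ _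
  have hvm : (v : ℝ) * m = v * (3 * v - 1 - 2 * k) := by rw [hmR, hnR]
  push_cast
  rw [hnR]
  linarith

lemma sum_rbinom2_eq_zero {k n : ℕ} (s : ℕ) (hk : 3 * k ≤ n) :
    ∑ j ∈ Finset.Icc 2 (s - 1), (j : ℝ) * ((j : ℝ) + 1) *
      rbinom2 ((k : ℝ) + 1 - cseq j * (n : ℝ)) = 0 := by
  apply Finset.sum_eq_zero
  intro j hj
  have hj2 : (2 : ℝ) ≤ j := by exact_mod_cast (Finset.mem_Icc.1 hj).1
  have hc : (1 : ℝ) / 3 ≤ cseq j := by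
    have : 1 / (3 * (j : ℝ) * (j + 1)) ≤ 1 / 6 :=
      one_div_le_one_div_of_le (by norm_num) (by nlinarith)
    unfold cseq
    linarith
  have hk' : (3 : ℝ) * k ≤ n := by exact_mod_cast hk
  have : (k : ℝ) + 1 - cseq j * n < 2 := by
    have : 1 / 3 * (n : ℝ) ≤ cseq j * n := mul_le_mul_of_nonneg_right hc (by positivity)
    linarith
  rw [rbinom2, if_neg (not_le.2 this), mul_zero]

/-- For a 3-decomposable set `P` of `n` points (with `3 ∣ n`) and `1 ≤ k < n/2`,
the number of `(≤ k)`-sets of `P` is at least `B(k,n)`. -/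
theorem chiLe_of_threeDecomposable_ge (n k s : ℕ) (hn : 0 < n) (h3 : 3 ∣ n)
    (hk1 : 1 ≤ k) (hk2 : 2 * k < n)
    (hs : 0 < s ∧ rbinom2 (s : ℝ) < (n : ℝ) / (3 * ((n : ℝ) - 2 * k - 1)) ∧
      (n : ℝ) / (3 * ((n : ℝ) - 2 * k - 1)) ≤ rbinom2 ((s : ℝ) + 1))
    (P : Finset (ℝ × ℝ)) (hcard : P.card = n) (hgp : GenPos P) (hdec : ThreeDecompPts P) :
    Bkn k n s ≤ (chiLe P k : ℝ) := by
  obtain ⟨v, hnv⟩ := h3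
  obtain ⟨A, B, C, hAB, hAC, hBC, hU, hA, hB, hC, v₁, v₂, v₃, h1, h2, h3, -, -, -, hall⟩ := hdec
  rw [hcard] at hA hB hC
  obtain ⟨a₀, ha₀⟩ := Finset.card_pos.1 (show 0 < A.card by omega)
  obtain ⟨b₀, hb₀⟩ := Finset.card_pos.1 (show 0 < B.card by omega)
  obtain ⟨c₀, hc₀⟩ := Finset.card_pos.1 (show 0 < C.card by omega)
  have hIA : IsInitial P v₂ A := by
    refine ⟨by rw [← hU]; grind, fun x hx y hy => ?_⟩
    have : y ∈ B ∨ y ∈ C := by grind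
    rcases this with hy | hy
    · exact (hall x hx y hy c₀ hc₀).2.2.1
    · have := hall x hx b₀ hb₀ y hy
      linarith
  have hIB : IsInitial P v₁ B := by
    refine ⟨by rw [← hU]; grind, fun x hx y hy => ?_⟩
    have : y ∈ A ∨ y ∈ C := by grind
    rcases this with hy | hy
    · exact (hall y hy x hx c₀ hc₀).1
    · have := hall a₀ ha₀ x hx y hy
      linarith
  have hIC : IsInitial P (-v₁) C := by
    refine ⟨by rw [← hU]; grind, fun x hx y hy => ?_⟩
    have hneg : ∀ z, dot z (-v₁) = -dot z v₁ := fun z => by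
      simp only [dot, Prod.fst_neg, Prod.snd_neg]
      ring
    rw [hneg, hneg]
    have : y ∈ A ∨ y ∈ B := by grind
    rcases this with hy | hy
    · have := hall y hy b₀ hb₀ x hx
      linarith
    · have := hall a₀ ha₀ y hy x hx
      linarith
  have hχ := hgp.sum_noncentral_le_chiLe k
  rw [sum_offDiag_noncentral] at hχ
  set G : ℝ × ℝ → ℤ := fun p => ∑ q ∈ P.erase p, (1 - central P k p q) with hG
  have hsplit : ∑ p ∈ P, G p = ∑ p ∈ A, G p + ∑ p ∈ B, G p + ∑ p ∈ C, G p := by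
    rw [← hU, Finset.sum_union (Finset.disjoint_union_left.2 ⟨hAC, hBC⟩), Finset.sum_union hAB]
  rw [hsplit] at hχ
  have hχR : ((∑ p ∈ A, G p : ℤ) : ℝ) + (∑ p ∈ B, G p : ℤ) + (∑ p ∈ C, G p : ℤ) ≤
      2 * (chiLe P k : ℝ) := by exact_mod_cast hχ
  have hnR : (n : ℝ) = 3 * v := by rw [hnv]; push_cast; ring
  have hk1R : (1 : ℝ) ≤ k := by exact_mod_cast hk1
  have hb1 : rbinom2 ((k : ℝ) + 1) = (k + 1) * k / 2 := by
    rw [rbinom2, if_pos (by linarith)]; ring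
  rcases le_or_gt k v with hkv | hkv
  · have hb2 : rbinom2 ((k : ℝ) + 1 - n / 3) = 0 := by
      have : (k : ℝ) ≤ v := by exact_mod_cast hkv
      rw [rbinom2, if_neg (by rw [hnR]; linarith)]
    have hbound : ∀ {u : ℝ × ℝ} {X : Finset (ℝ × ℝ)}, u ≠ 0 → IsInitial P u X → X.card = v →
        (k : ℝ) * (k + 1) ≤ (∑ p ∈ X, G p : ℤ) := fun hu hX hXv => by
      exact_mod_cast hgp.noncentral_ge_of_le_card (hcard.symm ▸ hk2) hu hX (hXv.symm ▸ hkv)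
    have eA := hbound h2 hIA (by omega)
    have eB := hbound h1 hIB (by omega)
    have eC := hbound (neg_ne_zero.2 h1) hIC (by omega)
    rw [Bkn, sum_rbinom2_eq_zero s (by omega), hb1, hb2]
    linarith
  · have hb2 : rbinom2 ((k : ℝ) + 1 - n / 3) = ((k : ℝ) - v) * (k - v + 1) / 2 := by
      have : (v : ℝ) + 1 ≤ k := by exact_mod_cast hkv
      rw [rbinom2, if_pos (by rw [hnR]; linarith), hnR]; ring
    have eA := hgp.noncentral_ge_of_card_lt hcard hnv hk1 hk2 s h2 hIA (by omega) hkv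
    have eB := hgp.noncentral_ge_of_card_lt hcard hnv hk1 hk2 s h1 hIB (by omega) hkv
    have eC := hgp.noncentral_ge_of_card_lt hcard hnv hk1 hk2 s (neg_ne_zero.2 h1) hIC
      (by omega) hkv
    rw [Bkn, hb1, hb2]
    linarith
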